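/- Let {h_i}_{i∈I} generate a parabolic Cantor set and let ℙ be any Borel probability measure on Σ for which the pressure P(s,q) := lim_{n→∞} (∑_{i∈I^n} ℙ([i])^q ‖h_i'‖_∞^s)^{1/n} exists. Then P(1,q) ≤ 1 for all q ≥ 0. -/

import Mathlib

open Set Filter MeasureTheory Metric Topology
open scoped ENNReal NNReal

/-- Composition of the maps along a finite word: `h_{i₁…iₙ} = h_{i₁} ∘ ⋯ ∘ h_{iₙ}`. -/
def wMap {I : Type} (h : I → ℝ → ℝ) : List I → ℝ → ℝ
  | [] => id
  | a :: t => h a ∘ wMap h t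

/-- Derivative cocycle of the composition along a finite word (chain rule). -/
def wDeriv {I : Type} (h h' : I → ℝ → ℝ) : List I → ℝ → ℝ
  | [] => fun _ => 1
  | a :: t => fun x => h' a (wMap h t x) * wDeriv h h' t x

/-- `‖h_w'‖_∞`, the sup of `|h_w'|` over `[0,1]`. -/
noncomputable def supD {I : Type} (h h' : I → ℝ → ℝ) (w : List I) : ℝ :=
  ⨆ x : Icc (0:ℝ) 1, |wDeriv h h' w x|

/-- The cylinder of infinite words beginning with the finite word `w`. -/
def cyl {I : Type} (w : List I) : Set (ℕ → I) := {ω | ∀ k : Fin w.length, ω k = w.get k}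

/-- A parabolic IFS on `[0,1]` satisfying A1', A2', A3' (parabolic Cantor set system). -/
structure PCantorIFS (I : Type) [Fintype I] where
  h : I → ℝ → ℝ
  h' : I → ℝ → ℝ
  αh : ℝ
  αh_pos : 0 < αh
  card : 2 ≤ Fintype.card I
  maps : ∀ i, MapsTo (h i) (Icc (0:ℝ) 1) (Icc (0:ℝ) 1)
  contract : ∀ i, ∀ x ∈ Icc (0:ℝ) 1, ∀ y ∈ Icc (0:ℝ) 1, x ≠ y → |h i x - h i y| < |x - y|
  hasDeriv : ∀ i, ∀ x ∈ Icc (0:ℝ) 1, HasDerivWithinAt (h i) (h' i x) (Icc (0:ℝ) 1) x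
  holder : ∃ C > 0, ∀ i, ∀ x ∈ Icc (0:ℝ) 1, ∀ y ∈ Icc (0:ℝ) 1,
      |h' i x - h' i y| ≤ C * |x - y| ^ αh
  nonzero : ∀ i, ∀ x ∈ Icc (0:ℝ) 1, h' i x ≠ 0
  sep : ∀ i j, i ≠ j → Disjoint (h i '' Ioo (0:ℝ) 1) (h j '' Ioo (0:ℝ) 1)

/-- The induced (hyperbolic) alphabet `I_∞ = {j i₀ : j ∈ (I ∖ {i₀})^*} ∪ {i₀}`. -/
def Iinf {I : Type} (i0 : I) : Set (List I) :=
  {w | ∃ j : List I, (∀ a ∈ j, a ≠ i0) ∧ w = j ++ [i0]}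

/-- Finite concatenations of words from `I_∞`. -/
def IinfStar {I : Type} (i0 : I) : Set (List I) :=
  {w | ∃ L : List (List I), (∀ u ∈ L, u ∈ Iinf i0) ∧ w = L.flatten}

/-- The truncated induced alphabet `I_N`. -/
def IN {I : Type} (i0 : I) (N : ℕ) : Set (List I) :=
  {w | w ∈ Iinf i0 ∧ w.length ≤ N}

/-- The weak quasi-Bernoulli property. -/
def WeakQB {I : Type} [MeasurableSpace I] (P : Measure (ℕ → I)) : Prop :=
  ∃ c : ℕ → ℝ, (∀ n, 0 < c n) ∧
    Tendsto (fun n : ℕ => c n ^ ((n : ℝ)⁻¹)) atTop (𝓝 1) ∧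
    ∀ L : List (List I), (∀ w ∈ L, w ≠ []) →
      ((L.map fun w => c w.length).prod)⁻¹ * (L.map fun w => (P (cyl w)).toReal).prod
          ≤ (P (cyl L.flatten)).toReal ∧
        (P (cyl L.flatten)).toReal
          ≤ (L.map fun w => c w.length).prod * (L.map fun w => (P (cyl w)).toReal).prod

/-- The quasi-Bernoulli property restricted to concatenations of words from `I_∞`. -/
def QBonInf {I : Type} [MeasurableSpace I] (P : Measure (ℕ → I)) (i0 : I) : Prop :=
  ∃ c : ℝ, 1 ≤ c ∧ ∀ u ∈ IinfStar i0, ∀ v ∈ IinfStar i0,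
    c⁻¹ * ((P (cyl u)).toReal * (P (cyl v)).toReal) ≤ (P (cyl (u ++ v))).toReal ∧
    (P (cyl (u ++ v))).toReal ≤ c * ((P (cyl u)).toReal * (P (cyl v)).toReal)

/-- The partition sums `∑_{i ∈ I^n} ℙ([i])^q ‖h_i'‖_∞^s` over the full alphabet. -/
noncomputable def pSum {I : Type} [Fintype I] [MeasurableSpace I]
    (P : Measure (ℕ → I)) (h h' : I → ℝ → ℝ) (n : ℕ) (s q : ℝ) : ℝ :=
  ∑ w : Fin n → I, (P (cyl (List.ofFn w))).toReal ^ q * supD h h' (List.ofFn w) ^ s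

/-- The partition sums over `n`-fold concatenations of words from an alphabet `J` of
finite words. -/
noncomputable def zSum {I : Type} [MeasurableSpace I]
    (P : Measure (ℕ → I)) (h h' : I → ℝ → ℝ) (J : Set (List I)) (n : ℕ) (s q : ℝ) : ℝ :=
  ∑' w : Fin n → ↥J,
    (P (cyl (List.flatten (List.ofFn fun k => ((w k : List I)))))).toReal ^ q *
      supD h h' (List.flatten (List.ofFn fun k => ((w k : List I)))) ^ s

/-- `x ^ q` with the convention `0^0 = 0` used for moment sums. -/
noncomputable def pw (a q : ℝ) : ℝ := if a = 0 then 0 else a ^ q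

/-- The `q`-th moment sum of a measure on `ℝ` over the closed intervals of the `δ`-mesh. -/
noncomputable def Dq1 (ν : Measure ℝ) (q δ : ℝ) : ℝ :=
  ∑' k : ℤ, pw ((ν (Icc ((k : ℝ) * δ) (((k : ℝ) + 1) * δ))).toReal) q

/-- Number of intervals of the `δ`-mesh which intersect `F ⊆ ℝ`. -/
noncomputable def covCount (F : Set ℝ) (δ : ℝ) : ℕ :=
  Set.ncard {k : ℤ | (Icc ((k : ℝ) * δ) (((k : ℝ) + 1) * δ) ∩ F).Nonempty}

namespace PCantorIFS

variable {I : Type} [Fintype I] (S : PCantorIFS I)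

lemma mapsTo_wMap (w : List I) : MapsTo (wMap S.h w) (Icc (0:ℝ) 1) (Icc (0:ℝ) 1) := by
  induction w with
  | nil => exact mapsTo_id _
  | cons a t ih => exact (S.maps a).comp ih

lemma hasDerivWithinAt_wMap (w : List I) {x : ℝ} (hx : x ∈ Icc (0:ℝ) 1) :
    HasDerivWithinAt (wMap S.h w) (wDeriv S.h S.h' w x) (Icc (0:ℝ) 1) x := by
  induction w with
  | nil => exact hasDerivWithinAt_id _ _
  | cons a t ih =>
    exact (S.hasDeriv a _ (S.mapsTo_wMap t hx)).comp x ih (S.mapsTo_wMap t)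

lemma continuousOn_wMap (w : List I) : ContinuousOn (wMap S.h w) (Icc (0:ℝ) 1) :=
  fun _ hx => (S.hasDerivWithinAt_wMap w hx).continuousWithinAt

lemma continuousOn_h (i : I) : ContinuousOn (S.h i) (Icc (0:ℝ) 1) :=
  fun x hx => (S.hasDeriv i x hx).continuousWithinAt

lemma continuousOn_deriv (i : I) : ContinuousOn (S.h' i) (Icc (0:ℝ) 1) := by
  obtain ⟨C, -, hC⟩ := S.holder
  intro x hx
  have hlim : Tendsto (fun y : ℝ => C * |y - x| ^ S.αh) (𝓝[Icc 0 1] x) (𝓝 0) := by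
    have hc : Continuous fun y : ℝ => C * |y - x| ^ S.αh :=
      continuous_const.mul
        ((continuous_id.sub continuous_const).abs.rpow_const fun _ => Or.inr S.αh_pos.le)
    have := (hc.tendsto x).mono_left (nhdsWithin_le_nhds (s := Icc (0:ℝ) 1))
    simpa [Real.zero_rpow S.αh_pos.ne'] using this
  refine tendsto_iff_dist_tendsto_zero.2 (squeeze_zero' (.of_forall fun _ => dist_nonneg) ?_ hlim)
  filter_upwards [self_mem_nhdsWithin] with y hy
  exact hC i y hy x hx

lemma injOn_h (i : I) : InjOn (S.h i) (Icc (0:ℝ) 1) := by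
  have key : ∀ x ∈ Icc (0:ℝ) 1, ∀ y ∈ Icc (0:ℝ) 1, x < y → S.h i x ≠ S.h i y := by
    intro x hx y hy hxy he
    have hsub : Icc x y ⊆ Icc (0:ℝ) 1 := Icc_subset_Icc hx.1 hy.2
    obtain ⟨c, hc, h0⟩ := exists_hasDerivAt_eq_zero (f := S.h i) (f' := S.h' i) hxy
      ((S.continuousOn_h i).mono hsub) he fun z hz =>
        (S.hasDeriv i z (hsub (Ioo_subset_Icc_self hz))).hasDerivAt
          (Icc_mem_nhds (hx.1.trans_lt hz.1) (hz.2.trans_le hy.2))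
    exact S.nonzero i c (hsub (Ioo_subset_Icc_self hc)) h0
  intro x hx y hy he
  rcases lt_trichotomy x y with h | h | h
  · exact absurd he (key x hx y hy h)
  · exact h
  · exact absurd he.symm (key y hy x hx h)

lemma mapsTo_h_Ioo (i : I) : MapsTo (S.h i) (Ioo (0:ℝ) 1) (Ioo (0:ℝ) 1) := by
  intro x hx
  have h0 := S.maps i (left_mem_Icc.2 zero_le_one)
  have h1 := S.maps i (right_mem_Icc.2 zero_le_one)
  have m0 : (0:ℝ) ∈ Icc (0:ℝ) 1 := left_mem_Icc.2 zero_le_one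
  have m1 : (1:ℝ) ∈ Icc (0:ℝ) 1 := right_mem_Icc.2 zero_le_one
  have mx := Ioo_subset_Icc_self hx
  rcases (S.continuousOn_h i).strictMonoOn_of_injOn_Icc' zero_le_one (S.injOn_h i) with h | h
  · exact ⟨h0.1.trans_lt (h m0 mx hx.1), (h mx m1 hx.2).trans_le h1.2⟩
  · exact ⟨h1.1.trans_lt (h mx m1 hx.2), (h m0 mx hx.1).trans_le h0.2⟩

lemma mapsTo_wMap_Ioo (w : List I) : MapsTo (wMap S.h w) (Ioo (0:ℝ) 1) (Ioo (0:ℝ) 1) := by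
  induction w with
  | nil => exact mapsTo_id _
  | cons a t ih => exact (S.mapsTo_h_Ioo a).comp ih

lemma disjoint_image_wMap {v w : List I} (hl : v.length = w.length) (hne : v ≠ w) :
    Disjoint (wMap S.h v '' Ioo (0:ℝ) 1) (wMap S.h w '' Ioo (0:ℝ) 1) := by
  induction v generalizing w with
  | nil => exact absurd (List.length_eq_zero_iff.1 hl.symm).symm hne
  | cons a t ih =>
    cases w with
    | nil => simp at hl
    | cons b u =>
      simp only [wMap, image_comp]
      by_cases hab : a = b
      · subst hab
        have hsub (l : List I) : wMap S.h l '' Ioo (0:ℝ) 1 ⊆ Icc (0:ℝ) 1 :=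
          (S.mapsTo_wMap_Ioo l).image_subset.trans Ioo_subset_Icc_self
        exact disjoint_image_image fun x hx y hy he =>
          (ih (by simpa using hl) (by simpa using hne)).ne_of_mem hx hy
            (S.injOn_h a (hsub t hx) (hsub u hy) he)
      · exact (S.sep a b hab).mono (image_mono (S.mapsTo_wMap_Ioo t).image_subset)
          (image_mono (S.mapsTo_wMap_Ioo u).image_subset)

lemma uIoo_subset_image_wMap (w : List I) :
    uIoo (wMap S.h w 0) (wMap S.h w 1) ⊆ wMap S.h w '' Ioo (0:ℝ) 1 := by
  rcases le_total (wMap S.h w 0) (wMap S.h w 1) with h | h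
  · rw [uIoo_of_le h]
    exact intermediate_value_Ioo zero_le_one (S.continuousOn_wMap w)
  · rw [uIoo_of_ge h]
    exact intermediate_value_Ioo' zero_le_one (S.continuousOn_wMap w)

lemma sum_abs_wMap_sub_le_one (n : ℕ) :
    ∑ w : Fin n → I, |wMap S.h (List.ofFn w) 1 - wMap S.h (List.ofFn w) 0| ≤ 1 := by
  set U : (Fin n → I) → Set ℝ := fun w =>
    uIoo (wMap S.h (List.ofFn w) 0) (wMap S.h (List.ofFn w) 1)
  have hd : Pairwise (Function.onFun Disjoint U) := fun v w hvw =>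
    (S.disjoint_image_wMap (by simp) (List.ofFn_injective.ne hvw)).mono
      (S.uIoo_subset_image_wMap _) (S.uIoo_subset_image_wMap _)
  have hsub : ⋃ w, U w ⊆ Icc (0:ℝ) 1 := iUnion_subset fun w =>
    (S.uIoo_subset_image_wMap _).trans
      ((S.mapsTo_wMap_Ioo _).image_subset.trans Ioo_subset_Icc_self)
  have hvol (w : Fin n → I) : volume (U w) =
      ENNReal.ofReal |wMap S.h (List.ofFn w) 1 - wMap S.h (List.ofFn w) 0| := by
    simp only [U, uIoo, Real.volume_Ioo, max_sub_min_eq_abs]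
  have h1 : ∑ w, volume (U w) ≤ 1 := by
    rw [← tsum_fintype (L := .unconditional _), ← measure_iUnion hd fun w => measurableSet_Ioo]
    simpa using measure_mono (μ := volume) hsub
  rw [← ENNReal.ofReal_le_ofReal_iff zero_le_one, ENNReal.ofReal_one,
    ENNReal.ofReal_sum_of_nonneg fun _ _ => abs_nonneg _]
  simpa only [hvol] using h1

lemma nonempty_index {I : Type} [Fintype I] (S : PCantorIFS I) : Nonempty I :=
  Fintype.card_pos_iff.1 (lt_of_lt_of_le zero_lt_two S.card)

lemma exists_le_abs_deriv : ∃ m > 0, ∀ i, ∀ x ∈ Icc (0:ℝ) 1, m ≤ |S.h' i x| := by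
  have hi (i : I) : ∃ m > 0, ∀ x ∈ Icc (0:ℝ) 1, m ≤ |S.h' i x| := by
    obtain ⟨x, hx, hmin⟩ := isCompact_Icc.exists_isMinOn (nonempty_Icc.2 zero_le_one)
      (S.continuousOn_deriv i).abs
    exact ⟨_, abs_pos.2 (S.nonzero i x hx), fun y hy => hmin hy⟩
  choose m hm hle using hi
  have := S.nonempty_index
  obtain ⟨j, hj⟩ := Finite.exists_min m
  exact ⟨m j, hm j, fun i x hx => (hj i).trans (hle i x hx)⟩

lemma exists_abs_deriv_le_mul {η : ℝ} (hη : 0 < η) : ∃ δ > 0, ∀ i, ∀ x ∈ Icc (0:ℝ) 1,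
    ∀ y ∈ Icc (0:ℝ) 1, |x - y| < δ → |S.h' i x| ≤ (1 + η) * |S.h' i y| := by
  obtain ⟨m, hm, hle⟩ := S.exists_le_abs_deriv
  have hi (i : I) : ∃ δ > 0, ∀ x ∈ Icc (0:ℝ) 1, ∀ y ∈ Icc (0:ℝ) 1, |x - y| < δ →
      |S.h' i x - S.h' i y| < η * m :=
    Metric.uniformContinuousOn_iff.1
      (isCompact_Icc.uniformContinuousOn_of_continuous (S.continuousOn_deriv i)) _ (mul_pos hη hm)
  choose δ hδ hclose using hi
  have := S.nonempty_index
  obtain ⟨j, hj⟩ := Finite.exists_min δ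
  refine ⟨δ j, hδ j, fun i x hx y hy hxy => ?_⟩
  have h1 := hclose i x hx y hy (hxy.trans_le (hj i))
  have h2 := abs_sub_abs_le_abs_sub (S.h' i x) (S.h' i y)
  have h3 := mul_le_mul_of_nonneg_left (hle i y hy) hη.le
  linarith

lemma exists_abs_deriv_le_const_mul : ∃ K ≥ 1, ∀ i, ∀ x ∈ Icc (0:ℝ) 1, ∀ y ∈ Icc (0:ℝ) 1,
    |S.h' i x| ≤ K * |S.h' i y| := by
  obtain ⟨m, hm, hle⟩ := S.exists_le_abs_deriv
  obtain ⟨C, hC, hC'⟩ := S.holder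
  refine ⟨1 + C / m, le_add_of_nonneg_right (by positivity), fun i x hx y hy => ?_⟩
  have h1 : |x - y| ^ S.αh ≤ 1 := Real.rpow_le_one (abs_nonneg _)
    (abs_sub_le_iff.2 ⟨by linarith [hx.2, hy.1], by linarith [hy.2, hx.1]⟩) S.αh_pos.le
  have h2 := abs_sub_abs_le_abs_sub (S.h' i x) (S.h' i y)
  have h3 := hC' i x hx y hy
  have h4 : C * |x - y| ^ S.αh ≤ C := mul_le_of_le_one_right hC.le h1
  have h5 : C ≤ C / m * |S.h' i y| := by
    rw [div_mul_eq_mul_div, le_div_iff₀ hm]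
    exact mul_le_mul_of_nonneg_left (hle i y hy) hC.le
  linarith

lemma exists_contract_sub {ε : ℝ} (hε : 0 < ε) : ∃ δ > 0, ∀ i, ∀ x ∈ Icc (0:ℝ) 1,
    ∀ y ∈ Icc (0:ℝ) 1, ε ≤ |x - y| → |S.h i x - S.h i y| ≤ |x - y| - δ := by
  have hi (i : I) : ∃ δ > 0, ∀ x ∈ Icc (0:ℝ) 1,
      ∀ y ∈ Icc (0:ℝ) 1, ε ≤ |x - y| → |S.h i x - S.h i y| ≤ |x - y| - δ := by
    set T : Set (ℝ × ℝ) := (Icc (0:ℝ) 1 ×ˢ Icc (0:ℝ) 1) ∩ {p | ε ≤ |p.1 - p.2|}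
    have hT : IsCompact T := (isCompact_Icc.prod isCompact_Icc).inter_right
      (isClosed_le continuous_const (by fun_prop))
    have hcont : ContinuousOn (fun p : ℝ × ℝ => |p.1 - p.2| - |S.h i p.1 - S.h i p.2|) T := by
      refine ContinuousOn.sub (by fun_prop) (ContinuousOn.abs (ContinuousOn.sub ?_ ?_))
      · exact (S.continuousOn_h i).comp continuousOn_fst fun p hp => hp.1.1
      · exact (S.continuousOn_h i).comp continuousOn_snd fun p hp => hp.1.2
    rcases T.eq_empty_or_nonempty with he | hne
    · exact ⟨1, one_pos, fun x hx y hy hxy =>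
        absurd (show (x, y) ∈ T from ⟨⟨hx, hy⟩, hxy⟩) (by simp [he])⟩
    · obtain ⟨p, hp, hmin⟩ := hT.exists_isMinOn hne hcont
      have hpne : p.1 ≠ p.2 := fun h => by
        have h2 : ε ≤ |p.1 - p.2| := hp.2
        rw [h, sub_self, abs_zero] at h2
        exact h2.not_gt hε
      refine ⟨_, sub_pos.2 (S.contract i p.1 hp.1.1 p.2 hp.1.2 hpne), fun x hx y hy hxy => ?_⟩
      have h3 : |p.1 - p.2| - |S.h i p.1 - S.h i p.2| ≤ |x - y| - |S.h i x - S.h i y| :=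
        hmin (show (x, y) ∈ T from ⟨⟨hx, hy⟩, hxy⟩)
      linarith
  choose δ hδ hle using hi
  have := S.nonempty_index
  obtain ⟨j, hj⟩ := Finite.exists_min δ
  exact ⟨δ j, hδ j, fun i x hx y hy hxy => (hle i x hx y hy hxy).trans
    (sub_le_sub_left (hj i) _)⟩

lemma abs_h_sub_le (i : I) {x y : ℝ} (hx : x ∈ Icc (0:ℝ) 1) (hy : y ∈ Icc (0:ℝ) 1) :
    |S.h i x - S.h i y| ≤ |x - y| := by
  rcases eq_or_ne x y with rfl | hne
  · simp
  · exact (S.contract i x hx y hy hne).le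

/-- The images of the unit interval along words of length `n` shrink uniformly as `n → ∞`. -/
lemma exists_abs_wMap_sub_lt {ε : ℝ} (hε : 0 < ε) : ∃ N : ℕ, ∀ w : List I, N ≤ w.length →
    ∀ x ∈ Icc (0:ℝ) 1, ∀ y ∈ Icc (0:ℝ) 1, |wMap S.h w x - wMap S.h w y| < ε := by
  obtain ⟨δ, hδ, hle⟩ := S.exists_contract_sub hε
  have key (x : ℝ) (hx : x ∈ Icc (0:ℝ) 1) (y : ℝ) (hy : y ∈ Icc (0:ℝ) 1) (w : List I) :
      |wMap S.h w x - wMap S.h w y| < ε ∨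
        |wMap S.h w x - wMap S.h w y| ≤ 1 - w.length * δ := by
    induction w with
    | nil =>
      right
      simpa [wMap] using abs_sub_le_iff.2
        ⟨show x - y ≤ 1 by linarith [hx.2, hy.1], show y - x ≤ 1 by linarith [hy.2, hx.1]⟩
    | cons a t ih =>
      have hx' := S.mapsTo_wMap t hx
      have hy' := S.mapsTo_wMap t hy
      rcases lt_or_ge |wMap S.h t x - wMap S.h t y| ε with h | h
      · exact Or.inl ((S.abs_h_sub_le a hx' hy').trans_lt h)
      · right
        have h1 := ih.resolve_left h.not_gt
        have h2 := hle a _ hx' _ hy' h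
        simp only [wMap, Function.comp_apply, List.length_cons, Nat.cast_succ]
        linarith
  obtain ⟨N, hN⟩ := exists_nat_gt (1 / δ)
  refine ⟨N, fun w hw x hx y hy => (key x hx y hy w).resolve_right fun h => ?_⟩
  have h1 : 1 < (w.length : ℝ) * δ :=
    (div_lt_iff₀ hδ).1 (hN.trans_le (Nat.cast_le.2 hw))
  linarith [abs_nonneg (wMap S.h w x - wMap S.h w y)]

/-- Subexponential bounded distortion. -/
lemma exists_abs_wDeriv_le {η : ℝ} (hη : 0 < η) : ∃ C > 0, ∀ w : List I,
    ∀ x ∈ Icc (0:ℝ) 1, ∀ y ∈ Icc (0:ℝ) 1,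
      |wDeriv S.h S.h' w x| ≤ C * (1 + η) ^ w.length * |wDeriv S.h S.h' w y| := by
  obtain ⟨K, hK, hKle⟩ := S.exists_abs_deriv_le_const_mul
  obtain ⟨δ, hδ, hδle⟩ := S.exists_abs_deriv_le_mul hη
  obtain ⟨N, hN⟩ := S.exists_abs_wMap_sub_lt hδ
  have hK0 : 0 < K := one_pos.trans_le hK
  have key (x : ℝ) (hx : x ∈ Icc (0:ℝ) 1) (y : ℝ) (hy : y ∈ Icc (0:ℝ) 1) (w : List I) :
      |wDeriv S.h S.h' w x| ≤
        K ^ min w.length N * (1 + η) ^ w.length * |wDeriv S.h S.h' w y| := by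
    induction w with
    | nil => simp [wDeriv]
    | cons a t ih =>
      have hx' := S.mapsTo_wMap t hx
      have hy' := S.mapsTo_wMap t hy
      simp only [wDeriv, abs_mul, List.length_cons]
      rcases le_or_gt N t.length with h | h
      · rw [min_eq_right (h.trans t.length.le_succ)]
        rw [min_eq_right h] at ih
        calc _ ≤ ((1 + η) * |S.h' a (wMap S.h t y)|) *
              (K ^ N * (1 + η) ^ t.length * |wDeriv S.h S.h' t y|) :=
              mul_le_mul (hδle a _ hx' _ hy' (hN t h x hx y hy)) ih (abs_nonneg _) (by positivity)
          _ = _ := by ring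
      · rw [min_eq_left (Nat.succ_le_of_lt h)]
        rw [min_eq_left h.le] at ih
        calc _ ≤ (K * |S.h' a (wMap S.h t y)|) *
              (K ^ t.length * (1 + η) ^ t.length * |wDeriv S.h S.h' t y|) :=
              mul_le_mul (hKle a _ hx' _ hy') ih (abs_nonneg _) (by positivity)
          _ = K ^ (t.length + 1) * (1 + η) ^ t.length *
              (|S.h' a (wMap S.h t y)| * |wDeriv S.h S.h' t y|) := by ring
          _ ≤ _ := by
              gcongr
              · linarith
              · exact Nat.le_succ _
  refine ⟨K ^ N, by positivity, fun w x hx y hy => (key x hx y hy w).trans ?_⟩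
  gcongr
  exact min_le_right _ _

lemma supD_nonneg (w : List I) : 0 ≤ supD S.h S.h' w :=
  Real.iSup_nonneg fun _ => abs_nonneg _

lemma exists_abs_wDeriv_eq (w : List I) : ∃ y ∈ Icc (0:ℝ) 1,
    |wDeriv S.h S.h' w y| = |wMap S.h w 1 - wMap S.h w 0| := by
  obtain ⟨c, hc, he⟩ := exists_hasDerivAt_eq_slope (wMap S.h w) (wDeriv S.h S.h' w) one_pos
    (S.continuousOn_wMap w) fun x hx =>
      (S.hasDerivWithinAt_wMap w (Ioo_subset_Icc_self hx)).hasDerivAt (Icc_mem_nhds hx.1 hx.2)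
  exact ⟨c, Ioo_subset_Icc_self hc, by rw [he, sub_zero, div_one]⟩

lemma exists_sum_supD_le {η : ℝ} (hη : 0 < η) : ∃ C > 0, ∀ n : ℕ,
    ∑ w : Fin n → I, supD S.h S.h' (List.ofFn w) ≤ C * (1 + η) ^ n := by
  obtain ⟨C, hC, hle⟩ := S.exists_abs_wDeriv_le hη
  refine ⟨C, hC, fun n => ?_⟩
  have hw (w : Fin n → I) : supD S.h S.h' (List.ofFn w) ≤
      C * (1 + η) ^ n * |wMap S.h (List.ofFn w) 1 - wMap S.h (List.ofFn w) 0| := by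
    obtain ⟨y, hy, he⟩ := S.exists_abs_wDeriv_eq (List.ofFn w)
    rw [← he]
    exact ciSup_le fun x => by simpa using hle (List.ofFn w) x x.2 y hy
  calc _ ≤ _ := Finset.sum_le_sum fun w _ => hw w
    _ ≤ _ := by
      rw [← Finset.mul_sum]
      exact mul_le_of_le_one_right (by positivity) (S.sum_abs_wMap_sub_le_one n)

lemma pSum_one_le [MeasurableSpace I] (P : Measure (ℕ → I)) [IsProbabilityMeasure P] (n : ℕ)
    {q : ℝ} (hq : 0 ≤ q) :
    pSum P S.h S.h' n 1 q ≤ ∑ w : Fin n → I, supD S.h S.h' (List.ofFn w) := by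
  refine Finset.sum_le_sum fun w _ => ?_
  rw [Real.rpow_one]
  exact mul_le_of_le_one_left (S.supD_nonneg _)
    (Real.rpow_le_one ENNReal.toReal_nonneg measureReal_le_one hq)

lemma pSum_one_nonneg [MeasurableSpace I] (P : Measure (ℕ → I)) (n : ℕ) (q : ℝ) :
    0 ≤ pSum P S.h S.h' n 1 q :=
  Finset.sum_nonneg fun _ _ => mul_nonneg (Real.rpow_nonneg ENNReal.toReal_nonneg _)
    (Real.rpow_nonneg (S.supD_nonneg _) _)

end PCantorIFS

/-- For any Borel probability measure on a parabolic Cantor set whose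
pressure exists, `P(1, q) ≤ 1` for all `q ≥ 0`. -/
theorem pressure_at_one_le_one {I : Type} [Fintype I] [MeasurableSpace I]
    (S : PCantorIFS I)
    (P : Measure (ℕ → I)) [IsProbabilityMeasure P] :
    ∀ q : ℝ, 0 ≤ q → ∀ L : ℝ,
      Tendsto (fun n : ℕ => pSum P S.h S.h' n 1 q ^ ((n : ℝ)⁻¹)) atTop (𝓝 L) → L ≤ 1 := by
  intro q hq L hL
  refine le_of_forall_pos_le_add fun η hη => ?_
  obtain ⟨C, hC, hle⟩ := S.exists_sum_supD_le hη
  have hroot : Tendsto (fun n : ℕ => C ^ ((n : ℝ)⁻¹) * (1 + η)) atTop (𝓝 (1 + η)) := by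
    have h0 := (Real.continuousAt_const_rpow (a := C) (b := 0) hC.ne').tendsto.comp
      (tendsto_inv_atTop_nhds_zero_nat (𝕜 := ℝ))
    simpa [Function.comp_def] using h0.mul_const (1 + η)
  refine le_of_tendsto_of_tendsto hL hroot ?_
  filter_upwards [eventually_ne_atTop 0] with n hn
  calc pSum P S.h S.h' n 1 q ^ ((n : ℝ)⁻¹) ≤ (C * (1 + η) ^ n) ^ ((n : ℝ)⁻¹) :=
        Real.rpow_le_rpow (S.pSum_one_nonneg P n q) ((S.pSum_one_le P n hq).trans (hle n))
          (by positivity)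
    _ = C ^ ((n : ℝ)⁻¹) * (1 + η) := by
        rw [Real.mul_rpow hC.le (by positivity), Real.pow_rpow_inv_natCast (by positivity) hn]
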